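/- Let N be a weight sequence in the class 𝓛𝓒 which is nonquasianalytic. If liminf_{p→∞} (ν_p/p)·∑_{k≥2p} 1/ν_k = 0, then liminf_{p→∞} (ν_p/p)·∑_{k≥p} 1/ν_k ≤ 1. -/

import Mathlib

open Filter

noncomputable def nuq (N : ℕ → ℝ) (p : ℕ) : ℝ := N p / N (p - 1)

def IsLC (N : ℕ → ℝ) : Prop :=
  (∀ p, 0 < N p) ∧ N 0 = 1 ∧ N 0 ≤ N 1 ∧
    (∀ p, 1 ≤ p → (N p) ^ 2 ≤ N (p - 1) * N (p + 1)) ∧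
    Tendsto (fun p : ℕ => (N p) ^ ((1 : ℝ) / p)) atTop atTop

def NQA (N : ℕ → ℝ) : Prop := Summable (fun p : ℕ => 1 / nuq N (p + 1))

noncomputable def tailSum (N : ℕ → ℝ) (p : ℕ) : ℝ := ∑' k : ℕ, 1 / nuq N (p + k)

noncomputable def lamSV (M N : ℕ → ℝ) (s p : ℕ) : ℝ :=
  ⨆ j : Fin p, (M p / ((s : ℝ) ^ p * N j)) ^ ((1 : ℝ) / ((p : ℝ) - (j : ℕ)))

def SVcond (M N : ℕ → ℝ) : Prop :=
  ∃ s : ℕ, 1 ≤ s ∧ ∃ B : ℝ, ∀ p : ℕ, 1 ≤ p → lamSV M N s p / p * tailSum N p ≤ B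

noncomputable def Lseq (N : ℕ → ℝ) (s p : ℕ) : ℝ :=
  if p = 0 then 1
  else (s : ℝ) ^ p * ⨅ j : Fin p, ((p : ℝ) / tailSum N p) ^ (p - (j : ℕ)) * N j

noncomputable def LseqC (N : ℕ → ℝ) (s : ℕ) (C : ℝ) (p : ℕ) : ℝ :=
  if p = 0 then 1
  else (s : ℝ) ^ p * ⨅ j : Fin p, (C * p / tailSum N p) ^ (p - (j : ℕ)) * N j

def Preceq (M N : ℕ → ℝ) : Prop :=
  ∃ B : ℝ, ∀ p : ℕ, 1 ≤ p → (M p / N p) ^ ((1 : ℝ) / p) ≤ B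

def SeqEquiv (M N : ℕ → ℝ) : Prop := Preceq M N ∧ Preceq N M

def Gamma1 (N : ℕ → ℝ) : Prop :=
  ∃ B : ℝ, ∀ p : ℕ, 1 ≤ p → nuq N p / p * tailSum N p ≤ B

def MG (N : ℕ → ℝ) : Prop :=
  ∃ C : ℝ, 1 ≤ C ∧ ∀ j k : ℕ, N (j + k) ≤ C ^ (j + k) * N j * N k

noncomputable def tauD (N : ℕ → ℝ) (p : ℕ) : ℝ := p / nuq N p + tailSum N p

noncomputable def sigmaD (N : ℕ → ℝ) (p : ℕ) : ℝ :=
  if p = 0 then 1 else tauD N 1 * p / tauD N p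

noncomputable def Sdesc (N : ℕ → ℝ) (p : ℕ) : ℝ :=
  ∏ i ∈ Finset.range (p + 1), sigmaD N i

def AlmostIncreasing (a : ℕ → ℝ) : Prop :=
  ∃ C : ℝ, 1 ≤ C ∧ ∀ p q : ℕ, 1 ≤ p → p ≤ q → a p ≤ C * a q

noncomputable def BorelMap (f : ℝ → ℂ) : ℕ → ℂ := fun p => iteratedDeriv p f 0

def DRoumieu (N : ℕ → ℝ) : Set (ℝ → ℂ) :=
  {f | ContDiff ℝ (⊤ : ℕ∞) f ∧ Function.support f ⊆ Set.Icc (-1 : ℝ) 1 ∧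
    ∃ C h : ℝ, 0 < C ∧ 0 < h ∧ ∀ p x, ‖iteratedDeriv p f x‖ ≤ C * h ^ p * N p}

def LambdaRoumieu (M : ℕ → ℝ) : Set (ℕ → ℂ) :=
  {a | ∃ C h : ℝ, 0 < C ∧ 0 < h ∧ ∀ p, ‖a p‖ ≤ C * h ^ p * M p}

def DBeurling (N : ℕ → ℝ) : Set (ℝ → ℂ) :=
  {f | ContDiff ℝ (⊤ : ℕ∞) f ∧ Function.support f ⊆ Set.Icc (-1 : ℝ) 1 ∧
    ∀ h : ℝ, 0 < h → ∃ C : ℝ, 0 < C ∧ ∀ p x, ‖iteratedDeriv p f x‖ ≤ C * h ^ p * N p}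

def LambdaBeurling (M : ℕ → ℝ) : Set (ℕ → ℂ) :=
  {a | ∀ h : ℝ, 0 < h → ∃ C : ℝ, 0 < C ∧ ∀ p, ‖a p‖ ≤ C * h ^ p * M p}

lemma IsLC.nuq_pos {N : ℕ → ℝ} (hN : IsLC N) (p : ℕ) : 0 < nuq N p :=
  div_pos (hN.1 p) (hN.1 (p - 1))

lemma IsLC.nuq_le_nuq_add {N : ℕ → ℝ} (hN : IsLC N) {p : ℕ} (hp : 1 ≤ p) (k : ℕ) :
    nuq N p ≤ nuq N (p + k) := by
  induction k with
  | zero => exact le_rfl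
  | succ k ih =>
    refine ih.trans ?_
    have hconv := hN.2.2.2.1 (p + k) (by omega)
    have hsub : p + (k + 1) - 1 = p + k := by omega
    unfold nuq
    rw [hsub, div_le_div_iff₀ (hN.1 _) (hN.1 _), ← add_assoc]
    linarith

lemma NQA.summable_tail {N : ℕ → ℝ} (hnq : NQA N) {p : ℕ} (hp : 1 ≤ p) :
    Summable (fun k : ℕ => 1 / nuq N (p + k)) := by
  obtain ⟨q, rfl⟩ := Nat.exists_eq_add_of_le' hp
  refine ((summable_nat_add_iff q).2 hnq).congr fun k => ?_
  rw [show k + q + 1 = q + 1 + k by ring]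

lemma NQA.tailSum_eq_sum_add {N : ℕ → ℝ} (hnq : NQA N) {p : ℕ} (hp : 1 ≤ p) :
    tailSum N p = ∑ k ∈ Finset.range p, 1 / nuq N (p + k) + tailSum N (2 * p) := by
  unfold tailSum
  rw [← (hnq.summable_tail hp).sum_add_tsum_nat_add p]
  congr 1
  refine tsum_congr fun k => ?_
  rw [show p + (k + p) = 2 * p + k by ring]

lemma NQA.tailSum_two_mul_le {N : ℕ → ℝ} (hnq : NQA N) (hN : IsLC N) {p : ℕ} (hp : 1 ≤ p) :
    tailSum N (2 * p) ≤ tailSum N p := by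
  rw [hnq.tailSum_eq_sum_add hp]
  exact le_add_of_nonneg_left
    (Finset.sum_nonneg fun k _ => (one_div_pos.2 (hN.nuq_pos (p + k))).le)

lemma NQA.tailSum_le_add {N : ℕ → ℝ} (hnq : NQA N) (hN : IsLC N) {p : ℕ} (hp : 1 ≤ p) :
    tailSum N p ≤ p / nuq N p + tailSum N (2 * p) := by
  rw [hnq.tailSum_eq_sum_add hp]
  gcongr
  calc ∑ k ∈ Finset.range p, 1 / nuq N (p + k)
      ≤ ∑ _k ∈ Finset.range p, 1 / nuq N p :=
        Finset.sum_le_sum fun k _ =>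
          one_div_le_one_div_of_le (hN.nuq_pos p) (hN.nuq_le_nuq_add hp k)
    _ = p / nuq N p := by simp [div_eq_mul_inv]

/-- No boundedness of `f` or `g` is needed: if `g` tends to infinity then so does `f`, and both
lower limits take the default value `0`. -/
lemma liminf_le_of_le_add_of_liminf_eq_zero {f g : ℕ → ℝ} {c : ℝ} (hc : 0 ≤ c)
    (hgf : ∀ᶠ p in atTop, g p ≤ f p) (hfg : ∀ᶠ p in atTop, f p ≤ c + g p)
    (hg : liminf g atTop = 0) : liminf f atTop ≤ c := by
  rw [liminf_eq] at hg ⊢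
  by_cases hbdd : BddAbove {a | ∀ᶠ p in atTop, a ≤ f p}
  · have hbdd_g : BddAbove {a | ∀ᶠ p in atTop, a ≤ g p} :=
      hbdd.mono fun a ha => by
        filter_upwards [ha, hgf] with p h₁ h₂ using h₁.trans h₂
    refine Real.sSup_le (fun a ha => ?_) hc
    have hmem : a - c ∈ {a | ∀ᶠ p in atTop, a ≤ g p} := by
      filter_upwards [ha, hfg] with p h₁ h₂
      linarith
    have := le_csSup hbdd_g hmem
    linarith
  · rwa [Real.sSup_of_not_bddAbove hbdd]

theorem stmt11 (N : ℕ → ℝ) (hN : IsLC N) (hnq : NQA N)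
    (h0 : Filter.liminf (fun p : ℕ => nuq N p / p * tailSum N (2 * p)) Filter.atTop = 0) :
    Filter.liminf (fun p : ℕ => nuq N p / p * tailSum N p) Filter.atTop ≤ 1 := by
  refine liminf_le_of_le_add_of_liminf_eq_zero zero_le_one ?_ ?_ h0
  · filter_upwards [eventually_ge_atTop 1] with p hp
    have hν := hN.nuq_pos p
    exact mul_le_mul_of_nonneg_left (hnq.tailSum_two_mul_le hN hp) (by positivity)
  · filter_upwards [eventually_ge_atTop 1] with p hp
    have hν := hN.nuq_pos p
    have hp' : (0 : ℝ) < p := by exact_mod_cast hp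
    calc nuq N p / p * tailSum N p
        ≤ nuq N p / p * (p / nuq N p + tailSum N (2 * p)) :=
          mul_le_mul_of_nonneg_left (hnq.tailSum_le_add hN hp) (by positivity)
      _ = 1 + nuq N p / p * tailSum N (2 * p) := by field_simp
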